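/- Let S ⊆ ℝ³ be the set of points (x, y, z) satisfying all of the following: x ≥ 0, y ≥ 0, z ≥ x, z ≥ y; (z < x + 1 ∨ z < y + 1); (x < 1 ∨ z < x ∨ z < y + 1); (y < 1 ∨ z < x + 1 ∨ z < y); and (x < 1 ∨ y < 1 ∨ z < x ∨ z < y). Let T ⊆ ℝ³ be the set of points (x, y, z) satisfying 0 ≤ x ≤ 1, 0 ≤ y ≤ 1, x ≤ z < 1 + x, and y ≤ z < 1 + y. Then the 3-dimensional Lebesgue measures satisfy vol(S) = 4/3, vol(T) = 2/3, and hence vol(S) + vol(T) = 2. -/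

import Mathlib

open MeasureTheory

/-- The Hilbert-Kunz polytope for the Segre product B_R((x),(x)), R = k[x]. -/
def S : Set (ℝ × ℝ × ℝ) :=
  {p | 0 ≤ p.1 ∧ 0 ≤ p.2.1 ∧ p.1 ≤ p.2.2 ∧ p.2.1 ≤ p.2.2 ∧
       (p.2.2 < p.1 + 1 ∨ p.2.2 < p.2.1 + 1) ∧
       (p.1 < 1 ∨ p.2.2 < p.1 ∨ p.2.2 < p.2.1 + 1) ∧
       (p.2.1 < 1 ∨ p.2.2 < p.1 + 1 ∨ p.2.2 < p.2.1) ∧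
       (p.1 < 1 ∨ p.2.1 < 1 ∨ p.2.2 < p.1 ∨ p.2.2 < p.2.1)}

/-- The F-signature polytope for the Segre product B_R((x),(x)), R = k[x]. -/
def T : Set (ℝ × ℝ × ℝ) :=
  {p | 0 ≤ p.1 ∧ p.1 ≤ 1 ∧ 0 ≤ p.2.1 ∧ p.2.1 ≤ 1 ∧
       p.1 ≤ p.2.2 ∧ p.2.2 < 1 + p.1 ∧
       p.2.1 ≤ p.2.2 ∧ p.2.2 < 1 + p.2.1}

open Set

/-- The volume of the region between the graphs of two continuous functions over a rectangle
with sides `A` and `B`, up to null sets. -/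
theorem volume_between_graphs {A B : Set ℝ} {a b c d : ℝ} (hA : A =ᵐ[volume] Ioc a b)
    (hB : B =ᵐ[volume] Ioc c d) (hAm : MeasurableSet A) (hBm : MeasurableSet B)
    (hab : a ≤ b) (hcd : c ≤ d) {u v : ℝ × ℝ → ℝ} (hu : Continuous u) (hv : Continuous v) :
    volume {p : ℝ × ℝ × ℝ | p.1 ∈ A ∧ p.2.1 ∈ B ∧ p.2.2 ∈ Ico (u (p.1, p.2.1)) (v (p.1, p.2.1))} =
      ENNReal.ofReal (∫ x in a..b, ∫ y in c..d, max (v (x, y) - u (x, y)) 0) := by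
  have hF : Continuous fun p : ℝ × ℝ => max (v p - u p) 0 := by fun_prop
  have hG : Continuous fun x : ℝ => ∫ y in c..d, max (v (x, y) - u (x, y)) 0 :=
    intervalIntegral.continuous_parametric_intervalIntegral_of_continuous' hF c d
  have hm : MeasurableSet {p : ℝ × ℝ × ℝ | p.1 ∈ A ∧ p.2.1 ∈ B ∧
      p.2.2 ∈ Ico (u (p.1, p.2.1)) (v (p.1, p.2.1))} := by
    refine (measurable_fst hAm).inter (((measurable_fst.comp measurable_snd) hBm).inter ?_)
    have hproj : Measurable fun p : ℝ × ℝ × ℝ => (p.1, p.2.1) := by fun_prop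
    have hz : Measurable fun p : ℝ × ℝ × ℝ => p.2.2 := by fun_prop
    exact (measurableSet_le (hu.measurable.comp hproj) hz).inter
      (measurableSet_lt hz (hv.measurable.comp hproj))
  have inner (x : ℝ) : volume (Prod.mk x ⁻¹' {p : ℝ × ℝ × ℝ | p.1 ∈ A ∧ p.2.1 ∈ B ∧
      p.2.2 ∈ Ico (u (p.1, p.2.1)) (v (p.1, p.2.1))}) =
      A.indicator (fun x => ENNReal.ofReal (∫ y in c..d, max (v (x, y) - u (x, y)) 0)) x := by
    rw [Measure.volume_eq_prod, Measure.prod_apply (measurable_prodMk_left hm)]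
    by_cases hx : x ∈ A
    · have fiber (y : ℝ) : volume (Prod.mk y ⁻¹' (Prod.mk x ⁻¹' {p : ℝ × ℝ × ℝ | p.1 ∈ A ∧
          p.2.1 ∈ B ∧ p.2.2 ∈ Ico (u (p.1, p.2.1)) (v (p.1, p.2.1))})) =
          B.indicator (fun y => ENNReal.ofReal (max (v (x, y) - u (x, y)) 0)) y := by
        by_cases hy : y ∈ B
        · have : Prod.mk y ⁻¹' (Prod.mk x ⁻¹' {p : ℝ × ℝ × ℝ | p.1 ∈ A ∧
              p.2.1 ∈ B ∧ p.2.2 ∈ Ico (u (p.1, p.2.1)) (v (p.1, p.2.1))}) =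
              Ico (u (x, y)) (v (x, y)) := by
            ext z; simp [hx, hy]
          rw [this, Real.volume_Ico, indicator_of_mem hy, ENNReal.ofReal_max]
          simp
        · simp [hy]
      simp_rw [fiber]
      rw [lintegral_indicator hBm, setLIntegral_congr hB, indicator_of_mem hx,
        intervalIntegral.integral_of_le hcd, ofReal_integral_eq_lintegral_ofReal]
      · exact ((hF.comp (Continuous.prodMk_right x)).intervalIntegrable c d).1
      · exact Filter.Eventually.of_forall fun y => le_max_right _ _
    · simp [hx]
  rw [Measure.volume_eq_prod, Measure.prod_apply hm]
  simp_rw [inner]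
  rw [lintegral_indicator hAm, setLIntegral_congr hA,
    intervalIntegral.integral_of_le hab, ofReal_integral_eq_lintegral_ofReal]
  · exact (hG.intervalIntegrable a b).1
  · exact Filter.Eventually.of_forall fun x =>
      intervalIntegral.integral_nonneg hcd fun y _ => le_max_right _ _

theorem integral_congr_of_le {f g : ℝ → ℝ} {a b : ℝ} (hab : a ≤ b)
    (h : ∀ x, a ≤ x → x ≤ b → f x = g x) : ∫ x in a..b, f x = ∫ x in a..b, g x :=
  intervalIntegral.integral_congr fun x hx => by
    rw [uIcc_of_le hab] at hx
    exact h x hx.1 hx.2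

theorem integral_eq_sub_of_quadratic (a b p q r : ℝ) :
    ∫ x in a..b, (p + q * x + r * x ^ 2) =
      (p * b + q * b ^ 2 / 2 + r * b ^ 3 / 3) - (p * a + q * a ^ 2 / 2 + r * a ^ 3 / 3) := by
  rw [intervalIntegral.integral_add, intervalIntegral.integral_add,
    intervalIntegral.integral_const_mul, intervalIntegral.integral_const_mul,
    intervalIntegral.integral_const, integral_id, integral_pow, smul_eq_mul]
  · norm_num
    ring
  all_goals exact Continuous.intervalIntegrable (by fun_prop) _ _

theorem integral_section_T {x : ℝ} (h0 : 0 ≤ x) (h1 : x ≤ 1) :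
    ∫ y in (0 : ℝ)..1, max (1 + min x y - max x y) 0 = 1 / 2 + 1 * x + (-1) * x ^ 2 := by
  rw [← intervalIntegral.integral_add_adjacent_intervals (b := x),
    integral_congr_of_le (g := fun y => (1 - x) + 1 * y + 0 * y ^ 2) h0,
    integral_congr_of_le (g := fun y => (1 + x) + (-1) * y + 0 * y ^ 2) h1,
    integral_eq_sub_of_quadratic, integral_eq_sub_of_quadratic]
  · ring
  · intro y hy hy'
    rw [min_eq_left hy, max_eq_right hy, max_eq_left (by linarith)]
    ring
  · intro y hy hy'
    rw [min_eq_right hy', max_eq_left hy', max_eq_left (by linarith)]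
    ring
  all_goals exact Continuous.intervalIntegrable (by fun_prop) _ _

theorem integral_section_S_right {x : ℝ} (h1 : 1 ≤ x) (h2 : x ≤ 2) :
    ∫ y in (0 : ℝ)..1, max (y + 1 - x) 0 = 2 + (-2) * x + 1 / 2 * x ^ 2 := by
  rw [← intervalIntegral.integral_add_adjacent_intervals (b := x - 1),
    integral_congr_of_le (g := fun y => 0 + 0 * y + 0 * y ^ 2) (by linarith : 0 ≤ x - 1),
    integral_congr_of_le (g := fun y => (1 - x) + 1 * y + 0 * y ^ 2) (by linarith : x - 1 ≤ 1),
    integral_eq_sub_of_quadratic, integral_eq_sub_of_quadratic]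
  · ring
  · intro y hy hy'
    rw [max_eq_left (by linarith)]
    ring
  · intro y hy hy'
    rw [max_eq_right (by linarith)]
    ring
  all_goals exact Continuous.intervalIntegrable (by fun_prop) _ _

theorem integral_section_S_left {x : ℝ} (h0 : 0 ≤ x) (h1 : x ≤ 1) :
    ∫ y in (1 : ℝ)..2, max (x + 1 - y) 0 = 0 + 0 * x + 1 / 2 * x ^ 2 := by
  rw [← intervalIntegral.integral_add_adjacent_intervals (b := x + 1),
    integral_congr_of_le (g := fun y => (x + 1) + (-1) * y + 0 * y ^ 2) (by linarith : 1 ≤ x + 1),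
    integral_congr_of_le (g := fun y => 0 + 0 * y + 0 * y ^ 2) (by linarith : x + 1 ≤ 2),
    integral_eq_sub_of_quadratic, integral_eq_sub_of_quadratic]
  · ring
  · intro y hy hy'
    rw [max_eq_right (by linarith)]
    ring
  · intro y hy hy'
    rw [max_eq_left (by linarith)]
    ring
  all_goals exact Continuous.intervalIntegrable (by fun_prop) _ _

theorem volume_T : volume T = 2 / 3 := by
  have h : T = {p : ℝ × ℝ × ℝ | p.1 ∈ Icc (0 : ℝ) 1 ∧ p.2.1 ∈ Icc (0 : ℝ) 1 ∧
      p.2.2 ∈ Ico (max p.1 p.2.1) (1 + min p.1 p.2.1)} := by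
    ext ⟨x, y, z⟩
    simp only [T, mem_ofPred_eq, mem_Icc, mem_Ico, max_le_iff, ← sub_lt_iff_lt_add', lt_min_iff]
    tauto
  rw [h, volume_between_graphs (u := fun q => max q.1 q.2) (v := fun q => 1 + min q.1 q.2)
    Ioc_ae_eq_Icc.symm Ioc_ae_eq_Icc.symm measurableSet_Icc measurableSet_Icc zero_le_one
    zero_le_one (by fun_prop) (by fun_prop),
    integral_congr_of_le zero_le_one fun x => integral_section_T, integral_eq_sub_of_quadratic]
  norm_num [ENNReal.ofReal_div_of_pos]

theorem volume_S : volume S = 4 / 3 := by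
  have h : S = {p : ℝ × ℝ × ℝ | p.1 ∈ Ico (0 : ℝ) 1 ∧ p.2.1 ∈ Ico (0 : ℝ) 1 ∧
        p.2.2 ∈ Ico (max p.1 p.2.1) (max p.1 p.2.1 + 1)} ∪
      ({p : ℝ × ℝ × ℝ | p.1 ∈ Ico (1 : ℝ) 2 ∧ p.2.1 ∈ Ico (0 : ℝ) 1 ∧
        p.2.2 ∈ Ico p.1 (p.2.1 + 1)} ∪
      {p : ℝ × ℝ × ℝ | p.1 ∈ Ico (0 : ℝ) 1 ∧ p.2.1 ∈ Ico (1 : ℝ) 2 ∧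
        p.2.2 ∈ Ico p.2.1 (p.1 + 1)}) := by
    ext ⟨x, y, z⟩
    simp only [S, mem_ofPred_eq, mem_union, mem_Ico, max_le_iff, ← sub_lt_iff_lt_add, lt_max_iff]
    grind
  have hm₂ : MeasurableSet {p : ℝ × ℝ × ℝ | p.1 ∈ Ico (1 : ℝ) 2 ∧ p.2.1 ∈ Ico (0 : ℝ) 1 ∧
      p.2.2 ∈ Ico p.1 (p.2.1 + 1)} := by
    simp only [mem_Ico]
    measurability
  have hm₃ : MeasurableSet {p : ℝ × ℝ × ℝ | p.1 ∈ Ico (0 : ℝ) 1 ∧ p.2.1 ∈ Ico (1 : ℝ) 2 ∧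
      p.2.2 ∈ Ico p.2.1 (p.1 + 1)} := by
    simp only [mem_Ico]
    measurability
  rw [h, measure_union _ (hm₂.union hm₃), measure_union _ hm₃,
    volume_between_graphs (u := fun q => max q.1 q.2) (v := fun q => max q.1 q.2 + 1)
      Ico_ae_eq_Ioc Ico_ae_eq_Ioc measurableSet_Ico measurableSet_Ico zero_le_one
      zero_le_one (by fun_prop) (by fun_prop),
    volume_between_graphs (u := fun q => q.1) (v := fun q => q.2 + 1)
      Ico_ae_eq_Ioc Ico_ae_eq_Ioc measurableSet_Ico measurableSet_Ico one_le_two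
      zero_le_one (by fun_prop) (by fun_prop),
    volume_between_graphs (u := fun q => q.2) (v := fun q => q.1 + 1)
      Ico_ae_eq_Ioc Ico_ae_eq_Ioc measurableSet_Ico measurableSet_Ico zero_le_one
      one_le_two (by fun_prop) (by fun_prop),
    integral_congr_of_le one_le_two fun x => integral_section_S_right,
    integral_congr_of_le zero_le_one fun x => integral_section_S_left,
    integral_eq_sub_of_quadratic, integral_eq_sub_of_quadratic,
    ← ENNReal.ofReal_add (by norm_num) (by norm_num),
    ← ENNReal.ofReal_add (by norm_num) (by norm_num)]
  · norm_num [ENNReal.ofReal_div_of_pos]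
  · rw [disjoint_left]
    rintro p ⟨hp, -⟩ ⟨hp', -⟩
    exact absurd hp.1 (not_le.mpr hp'.2)
  · rw [disjoint_left]
    rintro p ⟨hp, hq, -⟩ (⟨hp', -⟩ | ⟨-, hq', -⟩)
    · exact absurd hp'.1 (not_le.mpr hp.2)
    · exact absurd hq'.1 (not_le.mpr hq.2)

/-- For the Segre product, vol(S) = 4/3, vol(T) = 2/3, and vol(S) + vol(T) = 2. -/
theorem segre_volumes :
    volume S = 4 / 3 ∧ volume T = 2 / 3 ∧ volume S + volume T = 2 := by
  refine ⟨volume_S, volume_T, ?_⟩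
  rw [volume_S, volume_T, ENNReal.div_add_div_same]
  exact (ENNReal.eq_div_iff (by norm_num) (by norm_num)).mpr (by norm_num) |>.symm
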